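/- For tripartite states ρ_ABE and σ_ABE of a finite-dimensional system and λ ∈ (0,1), the conditional mutual information satisfies |I(A:B|E)_{λρ+(1−λ)σ} − λ I(A:B|E)_ρ − (1−λ) I(A:B|E)_σ| ≤ 2 h₂(λ), where I(A:B|E)_ω = H(ω_AE) + H(ω_BE) − H(ω_E) − H(ω_ABE) and h₂ is the binary entropy. -/

import Mathlib

open scoped BigOperators Kronecker ComplexOrder
open Matrix

noncomputable section

def binEnt (l : ℝ) : ℝ := Real.negMulLog l + Real.negMulLog (1 - l)

def vN {n : Type*} [Fintype n] [DecidableEq n] (ρ : Matrix n n ℂ) : ℝ :=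
  if h : ρ.IsHermitian then ∑ i, Real.negMulLog (h.eigenvalues i) else 0

def IsDensity {n : Type*} [Fintype n] [DecidableEq n] (ρ : Matrix n n ℂ) : Prop :=
  ρ.PosSemidef ∧ ρ.trace = 1

def IsPure {n : Type*} (ρ : Matrix n n ℂ) : Prop :=
  ∃ v : n → ℂ, ρ = Matrix.vecMulVec v (star v)

def ptrB {a b : Type*} [Fintype b] (ρ : Matrix (a × b) (a × b) ℂ) : Matrix a a ℂ :=
  Matrix.of fun i i' => ∑ j, ρ (i, j) (i', j)

def ptrA {a b : Type*} [Fintype a] (ρ : Matrix (a × b) (a × b) ℂ) : Matrix b b ℂ :=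
  Matrix.of fun j j' => ∑ i, ρ (i, j) (i, j')

def mutInfo {a b : Type*} [Fintype a] [Fintype b] [DecidableEq a] [DecidableEq b]
    (ρ : Matrix (a × b) (a × b) ℂ) : ℝ :=
  vN (ptrB ρ) + vN (ptrA ρ) - vN ρ

/- tripartite, index a × b × e -/
def tr3C {a b e : Type*} [Fintype e] (ρ : Matrix (a × b × e) (a × b × e) ℂ) :
    Matrix (a × b) (a × b) ℂ :=
  Matrix.of fun x y => ∑ k, ρ (x.1, x.2, k) (y.1, y.2, k)

def tr3B {a b e : Type*} [Fintype b] (ρ : Matrix (a × b × e) (a × b × e) ℂ) :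
    Matrix (a × e) (a × e) ℂ :=
  Matrix.of fun x y => ∑ j, ρ (x.1, j, x.2) (y.1, j, y.2)

def tr3A {a b e : Type*} [Fintype a] (ρ : Matrix (a × b × e) (a × b × e) ℂ) :
    Matrix (b × e) (b × e) ℂ :=
  Matrix.of fun x y => ∑ i, ρ (i, x.1, x.2) (i, y.1, y.2)

def m3A {a b e : Type*} [Fintype b] [Fintype e] (ρ : Matrix (a × b × e) (a × b × e) ℂ) :
    Matrix a a ℂ :=
  Matrix.of fun i i' => ∑ j, ∑ k, ρ (i, j, k) (i', j, k)

def m3B {a b e : Type*} [Fintype a] [Fintype e] (ρ : Matrix (a × b × e) (a × b × e) ℂ) :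
    Matrix b b ℂ :=
  Matrix.of fun j j' => ∑ i, ∑ k, ρ (i, j, k) (i, j', k)

def m3C {a b e : Type*} [Fintype a] [Fintype b] (ρ : Matrix (a × b × e) (a × b × e) ℂ) :
    Matrix e e ℂ :=
  Matrix.of fun k k' => ∑ i, ∑ j, ρ (i, j, k) (i, j, k')

/-- conditional mutual information I(A:B|E) for a state on a × b × e -/
def cmi3 {a b e : Type*} [Fintype a] [Fintype b] [Fintype e]
    [DecidableEq a] [DecidableEq b] [DecidableEq e]
    (ρ : Matrix (a × b × e) (a × b × e) ℂ) : ℝ :=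
  vN (tr3B ρ) + vN (tr3A ρ) - vN (m3C ρ) - vN ρ

theorem spec_ex {n : Type*} [Fintype n] [DecidableEq n] (A : Matrix n n ℂ) (hA : A.PosSemidef) :
    ∃ (U : Matrix n n ℂ) (d : n → ℝ), Uᴴ * U = 1 ∧ U * Uᴴ = 1 ∧
      A = U * diagonal (fun i => (d i : ℂ)) * Uᴴ ∧ (∀ i, 0 ≤ d i) ∧
      vN A = ∑ i, Real.negMulLog (d i) := by
  have hH := hA.isHermitian
  refine ⟨hH.eigenvectorUnitary, hH.eigenvalues, ?_, ?_, ?_, hA.eigenvalues_nonneg, ?_⟩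
  · exact Unitary.coe_star_mul_self hH.eigenvectorUnitary
  · exact Unitary.coe_mul_star_self hH.eigenvectorUnitary
  · have := hH.spectral_theorem
    rw [Unitary.conjStarAlgAut_apply] at this
    exact this
  · simp [vN, hH]

theorem vN_roots {n : Type*} [Fintype n] [DecidableEq n] (A : Matrix n n ℂ) (hA : A.IsHermitian) :
    vN A = (A.charpoly.roots.map (fun z => Real.negMulLog z.re)).sum := by
  rw [hA.roots_charpoly_eq_eigenvalues]
  simp [vN, hA]

theorem vN_mul_comm {m n : Type*} [Fintype n] [DecidableEq n] [Fintype m] [DecidableEq m]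
    (M : Matrix m n ℂ) : vN (M * Mᴴ) = vN (Mᴴ * M) := by
  rw [vN_roots _ (isHermitian_mul_conjTranspose_self M),
    vN_roots _ (isHermitian_conjTranspose_mul_self M)]
  have h := congrArg Polynomial.roots (charpoly_mul_comm' M Mᴴ)
  have hX : (Polynomial.X : Polynomial ℂ) ≠ 0 := Polynomial.X_ne_zero
  rw [Polynomial.roots_mul (mul_ne_zero (pow_ne_zero _ hX) (charpoly_monic _).ne_zero),
    Polynomial.roots_mul (mul_ne_zero (pow_ne_zero _ hX) (charpoly_monic _).ne_zero)] at h
  have h2 := congrArg (fun s => (Multiset.map (fun z : ℂ => Real.negMulLog z.re) s).sum) h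
  simpa [Multiset.map_nsmul, Multiset.sum_nsmul] using h2

theorem vN_le_diag {n : Type*} [Fintype n] [DecidableEq n] (A : Matrix n n ℂ)
    (hA : A.PosSemidef) : vN A ≤ ∑ i, Real.negMulLog (A i i).re := by
  obtain ⟨U, d, h1, h2, h3, h4, h5⟩ := spec_ex A hA
  have hrow : ∀ i, ∑ j, Complex.normSq (U i j) = 1 := by
    intro i
    have := congrArg Complex.re (congrFun (congrFun h2 i) i)
    simpa [Matrix.mul_apply, Complex.mul_conj] using this
  have hcol : ∀ j, ∑ i, Complex.normSq (U i j) = 1 := by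
    intro j
    have := congrArg Complex.re (congrFun (congrFun h1 j) j)
    simpa [Matrix.mul_apply, Complex.normSq_apply] using this
  have hd : ∀ i, (A i i).re = ∑ j, Complex.normSq (U i j) * d j := by
    intro i
    conv_lhs => rw [h3]
    rw [Matrix.mul_apply, Complex.re_sum]
    refine Finset.sum_congr rfl fun j _ => ?_
    simp [Matrix.mul_diagonal, Complex.normSq_apply]
    ring
  rw [h5]
  calc ∑ j, Real.negMulLog (d j)
      = ∑ i, ∑ j, Complex.normSq (U i j) * Real.negMulLog (d j) := by
        rw [Finset.sum_comm]
        refine Finset.sum_congr rfl fun j _ => ?_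
        rw [← Finset.sum_mul, hcol, one_mul]
    _ ≤ _ := by
        refine Finset.sum_le_sum fun i _ => ?_
        rw [hd i]
        exact Real.concaveOn_negMulLog.le_map_sum (t := Finset.univ)
          (w := fun j => Complex.normSq (U i j)) (p := d)
          (fun j _ => Complex.normSq_nonneg _) (hrow i) (fun j _ => h4 j)

theorem vN_conj {n : Type*} [Fintype n] [DecidableEq n] (A U : Matrix n n ℂ)
    (hA : A.PosSemidef) (h2 : U * Uᴴ = 1) : vN (Uᴴ * A * U) = vN A := by
  rw [vN_roots _ hA.isHermitian, vN_roots _ (hA.conjTranspose_mul_mul_same U).isHermitian,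
    charpoly_mul_comm, ← mul_assoc, h2, one_mul]

theorem vN_concave {n : Type*} [Fintype n] [DecidableEq n] (ρ σ : Matrix n n ℂ)
    (hρ : ρ.PosSemidef) (hσ : σ.PosSemidef) (l : ℝ) (h0 : 0 < l) (h1 : l < 1) :
    l * vN ρ + (1 - l) * vN σ ≤ vN ((l : ℂ) • ρ + ((1 - l : ℝ) : ℂ) • σ) := by
  have hl : (0 : ℂ) ≤ (l : ℂ) := by exact_mod_cast h0.le
  have hl' : (0 : ℂ) ≤ ((1 - l : ℝ) : ℂ) := by
    rw [Complex.zero_le_real]; linarith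
  have hω := (hρ.smul hl).add (hσ.smul hl')
  obtain ⟨U, d, g1, g2, g3, g4, g5⟩ := spec_ex _ hω
  have hP := hρ.conjTranspose_mul_mul_same U
  have hS := hσ.conjTranspose_mul_mul_same U
  have e : (l : ℂ) • (Uᴴ * ρ * U) + ((1 - l : ℝ) : ℂ) • (Uᴴ * σ * U)
      = diagonal (fun i => (d i : ℂ)) := by
    have : (l : ℂ) • (Uᴴ * ρ * U) + ((1 - l : ℝ) : ℂ) • (Uᴴ * σ * U)
      = Uᴴ * ((l : ℂ) • ρ + ((1 - l : ℝ) : ℂ) • σ) * U := by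
      simp [mul_add, add_mul]
    rw [this, g3]
    calc _ = (Uᴴ * U) * diagonal (fun i => (d i : ℂ)) * (Uᴴ * U) := by simp only [mul_assoc]
      _ = _ := by simp [g1]
  rw [g5, ← vN_conj ρ U hρ g2, ← vN_conj σ U hσ g2]
  have a1 := mul_le_mul_of_nonneg_left (vN_le_diag _ hP) h0.le
  have a2 := mul_le_mul_of_nonneg_left (vN_le_diag _ hS) (sub_pos.2 h1).le
  refine (add_le_add a1 a2).trans ?_
  rw [Finset.mul_sum, Finset.mul_sum, ← Finset.sum_add_distrib]
  refine Finset.sum_le_sum fun i _ => ?_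
  have hi := congrArg Complex.re (congrFun (congrFun e i) i)
  rw [Matrix.add_apply, Matrix.smul_apply, Matrix.smul_apply, smul_eq_mul, smul_eq_mul,
    Complex.add_re, Complex.re_ofReal_mul, Complex.re_ofReal_mul, diagonal_apply_eq,
    Complex.ofReal_re] at hi
  rw [← hi]
  have p1 : 0 ≤ ((Uᴴ * ρ * U) i i).re := (Complex.le_def.1 (hP.diag_nonneg (i := i))).1
  have p2 : 0 ≤ ((Uᴴ * σ * U) i i).re := (Complex.le_def.1 (hS.diag_nonneg (i := i))).1
  exact Real.concaveOn_negMulLog.2 p1 p2 h0.le (sub_pos.2 h1).le (by ring)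

theorem sqrt_ex {n : Type*} [Fintype n] [DecidableEq n] (A : Matrix n n ℂ) (hA : IsDensity A)
    (l : ℝ) (hl : 0 ≤ l) :
    ∃ L : Matrix n n ℂ, (l : ℂ) • A = L * Lᴴ ∧
      ∑ i, Real.negMulLog ((Lᴴ * L) i i).re = l * vN A + Real.negMulLog l := by
  obtain ⟨U, d, h1, h2, h3, h4, h5⟩ := spec_ex A hA.1
  have htr : ∑ i, d i = 1 := by
    have := hA.2
    rw [h3, Matrix.trace_mul_comm, ← mul_assoc, h1, one_mul, trace_diagonal] at this
    exact_mod_cast this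
  let s : Matrix n n ℂ := diagonal (fun i => ((Real.sqrt (l * d i) : ℝ) : ℂ))
  have hs : sᴴ = s := by
    simp only [s, diagonal_conjTranspose]
    congr 1
    ext i
    simp
  have hss : s * s = (l : ℂ) • diagonal (fun i => (d i : ℂ)) := by
    simp only [s, diagonal_mul_diagonal, ← diagonal_smul]
    congr 1
    ext i
    rw [← Complex.ofReal_mul, Real.mul_self_sqrt (mul_nonneg hl (h4 i))]
    simp
  refine ⟨U * s, ?_, ?_⟩
  · rw [conjTranspose_mul, hs]
    calc (l : ℂ) • A = U * ((l : ℂ) • diagonal (fun i => (d i : ℂ))) * Uᴴ := by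
          rw [h3]; simp
      _ = _ := by rw [← hss]; simp only [mul_assoc]
  · have : (U * s)ᴴ * (U * s) = (l : ℂ) • diagonal (fun i => (d i : ℂ)) := by
      rw [conjTranspose_mul, hs, ← hss]
      calc _ = s * (Uᴴ * U) * s := by simp only [mul_assoc]
        _ = _ := by simp [h1]
    rw [this, h5, Finset.mul_sum]
    have : ∀ i, Real.negMulLog (((l : ℂ) • diagonal (fun i => (d i : ℂ)) : Matrix n n ℂ) i i).re
        = l * Real.negMulLog (d i) + d i * Real.negMulLog l := by
      intro i
      simp [Real.negMulLog_mul]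
      ring
    simp only [this, Finset.sum_add_distrib, ← Finset.sum_mul, htr, one_mul]

theorem vN_upper {n : Type*} [Fintype n] [DecidableEq n] (ρ σ : Matrix n n ℂ)
    (hρ : IsDensity ρ) (hσ : IsDensity σ) (l : ℝ) (h0 : 0 < l) (h1 : l < 1) :
    vN ((l : ℂ) • ρ + ((1 - l : ℝ) : ℂ) • σ) ≤ l * vN ρ + (1 - l) * vN σ + binEnt l := by
  obtain ⟨L, a1, a2⟩ := sqrt_ex ρ hρ l h0.le
  obtain ⟨K, b1, b2⟩ := sqrt_ex σ hσ (1 - l) (sub_pos.2 h1).le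
  have e : (l : ℂ) • ρ + ((1 - l : ℝ) : ℂ) • σ = fromCols L K * (fromCols L K)ᴴ := by
    rw [a1, b1, conjTranspose_fromCols_eq_fromRows_conjTranspose, fromCols_mul_fromRows]
  rw [e, vN_mul_comm]
  refine (vN_le_diag _ (posSemidef_conjTranspose_mul_self _)).trans ?_
  rw [conjTranspose_fromCols_eq_fromRows_conjTranspose, fromRows_mul_fromCols,
    Fintype.sum_sum_type]
  simp only [fromBlocks_apply₁₁, fromBlocks_apply₂₂]
  rw [a2, b2, binEnt]
  linarith

section
variable {a b e : Type*} [Fintype a] [Fintype b] [Fintype e]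
    [DecidableEq a] [DecidableEq b] [DecidableEq e]

theorem dens_tr3B (ρ : Matrix (a × b × e) (a × b × e) ℂ) (h : IsDensity ρ) :
    IsDensity (tr3B ρ) := by
  constructor
  · have : tr3B ρ = ∑ j, ρ.submatrix (fun x : a × e => (x.1, j, x.2))
        (fun x : a × e => (x.1, j, x.2)) := by
      ext x y; simp [tr3B, Matrix.sum_apply]
    rw [this]
    exact posSemidef_sum _ fun j _ => h.1.submatrix _
  · rw [← h.2]
    simp only [Matrix.trace, tr3B, Matrix.diag_apply, Matrix.of_apply, Fintype.sum_prod_type]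
    exact Finset.sum_congr rfl fun i _ => Finset.sum_comm

theorem dens_tr3A (ρ : Matrix (a × b × e) (a × b × e) ℂ) (h : IsDensity ρ) :
    IsDensity (tr3A ρ) := by
  constructor
  · have : tr3A ρ = ∑ j, ρ.submatrix (fun x : b × e => (j, x.1, x.2))
        (fun x : b × e => (j, x.1, x.2)) := by
      ext x y; simp [tr3A, Matrix.sum_apply]
    rw [this]
    exact posSemidef_sum _ fun j _ => h.1.submatrix _
  · rw [← h.2]
    simp only [Matrix.trace, tr3A, Matrix.diag_apply, Matrix.of_apply]
    rw [Finset.sum_comm, Fintype.sum_prod_type]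

theorem dens_m3C (ρ : Matrix (a × b × e) (a × b × e) ℂ) (h : IsDensity ρ) :
    IsDensity (m3C ρ) := by
  constructor
  · have : m3C ρ = ∑ i, ∑ j, ρ.submatrix (fun x : e => (i, j, x)) (fun x : e => (i, j, x)) := by
      ext x y; simp [m3C, Matrix.sum_apply]
    rw [this]
    exact posSemidef_sum _ fun i _ => posSemidef_sum _ fun j _ => h.1.submatrix _
  · rw [← h.2]
    simp only [Matrix.trace, m3C, Matrix.diag_apply, Matrix.of_apply, Fintype.sum_prod_type]
    rw [Finset.sum_comm]
    exact Finset.sum_congr rfl fun i _ => Finset.sum_comm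

end

theorem stmt6 {a b e : Type*} [Fintype a] [Fintype b] [Fintype e]
    [DecidableEq a] [DecidableEq b] [DecidableEq e]
    (ρ σ : Matrix (a × b × e) (a × b × e) ℂ) (hρ : IsDensity ρ) (hσ : IsDensity σ)
    (l : ℝ) (h0 : 0 < l) (h1 : l < 1) :
    |cmi3 ((l : ℂ) • ρ + ((1 - l : ℝ) : ℂ) • σ) - l * cmi3 ρ - (1 - l) * cmi3 σ| ≤
      2 * binEnt l := by
  have eB : tr3B ((l : ℂ) • ρ + ((1 - l : ℝ) : ℂ) • σ)
      = (l : ℂ) • tr3B ρ + ((1 - l : ℝ) : ℂ) • tr3B σ := by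
    ext x y
    simp only [tr3B, Matrix.of_apply, Matrix.add_apply, Matrix.smul_apply,
      Finset.sum_add_distrib, Finset.smul_sum]
  have eA : tr3A ((l : ℂ) • ρ + ((1 - l : ℝ) : ℂ) • σ)
      = (l : ℂ) • tr3A ρ + ((1 - l : ℝ) : ℂ) • tr3A σ := by
    ext x y
    simp only [tr3A, Matrix.of_apply, Matrix.add_apply, Matrix.smul_apply,
      Finset.sum_add_distrib, Finset.smul_sum]
  have eC : m3C ((l : ℂ) • ρ + ((1 - l : ℝ) : ℂ) • σ)
      = (l : ℂ) • m3C ρ + ((1 - l : ℝ) : ℂ) • m3C σ := by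
    ext x y
    simp only [m3C, Matrix.of_apply, Matrix.add_apply, Matrix.smul_apply,
      Finset.sum_add_distrib, Finset.smul_sum]
  have rB := dens_tr3B ρ hρ
  have rA := dens_tr3A ρ hρ
  have rC := dens_m3C ρ hρ
  have sB := dens_tr3B σ hσ
  have sA := dens_tr3A σ hσ
  have sC := dens_m3C σ hσ
  have u1 := vN_upper _ _ rB sB l h0 h1
  have u2 := vN_upper _ _ rA sA l h0 h1
  have u3 := vN_upper _ _ rC sC l h0 h1
  have u4 := vN_upper _ _ hρ hσ l h0 h1
  have c1 := vN_concave _ _ rB.1 sB.1 l h0 h1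
  have c2 := vN_concave _ _ rA.1 sA.1 l h0 h1
  have c3 := vN_concave _ _ rC.1 sC.1 l h0 h1
  have c4 := vN_concave _ _ hρ.1 hσ.1 l h0 h1
  unfold cmi3
  rw [eB, eA, eC, abs_le]
  constructor <;> linarith

end
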